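/- There is no sequence β : ℤ → ℂ that is an admissible zero-mean symbol for (a, b) = (1, 1). (This is the Fourier-multiplier form of the statement that the quasi-geostrophic model equation ω_t + u ω_x = ω·𝓗ω, with ω = 𝓗∂u = (−Δ)^{1/2}u and u a smooth zero-mean function on the circle, cannot be realized as a metric Euler equation on Diff_0^∞(S^1) for any regular inertia operator of Fourier type.) -/

import Mathlib

/-- Real power `|n|^a` of the absolute value of an integer. -/
noncomputable def rpAbs (a : ℝ) (n : ℤ) : ℝ := |(n : ℝ)| ^ a

/-- `β : ℤ → ℂ` is an admissible zero-mean symbol for `(a, b)`: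
(i) `β 0 = 0`; (ii) `β k ≠ 0` for `k ≠ 0`;
(iii) for nonzero `j, k` with `j + k ≠ 0`,
  `|j+k|^a (β j (2k+j) + β k (2j+k)) = β (j+k) (b (k|j|^a + j|k|^a) + k|k|^a + j|j|^a)`;
(iv) for nonzero `j, k` with `j + k = 0`, `β j (2k+j) + β k (2j+k) = 0`. -/
def AdmissibleZeroMeanSymbol (a b : ℝ) (β : ℤ → ℂ) : Prop :=
  β 0 = 0 ∧
  (∀ k : ℤ, k ≠ 0 → β k ≠ 0) ∧
  (∀ j k : ℤ, j ≠ 0 → k ≠ 0 → j + k ≠ 0 →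
    (rpAbs a (j + k) : ℂ) * (β j * (2 * (k : ℂ) + (j : ℂ)) + β k * (2 * (j : ℂ) + (k : ℂ))) =
      β (j + k) *
        ((b * ((k : ℝ) * rpAbs a j + (j : ℝ) * rpAbs a k) +
            (k : ℝ) * rpAbs a k + (j : ℝ) * rpAbs a j : ℝ) : ℂ)) ∧
  (∀ j k : ℤ, j ≠ 0 → k ≠ 0 → j + k = 0 →
    β j * (2 * (k : ℂ) + (j : ℂ)) + β k * (2 * (j : ℂ) + (k : ℂ)) = 0)

theorem quasi_geostrophic_not_metric :
    ¬ ∃ β : ℤ → ℂ, AdmissibleZeroMeanSymbol 1 1 β := by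
  rintro ⟨β, -, hne, h, -⟩
  have h11 := h 1 1 (by norm_num) (by norm_num) (by norm_num)
  have h12 := h 1 2 (by norm_num) (by norm_num) (by norm_num)
  have h13 := h 1 3 (by norm_num) (by norm_num) (by norm_num)
  have h22 := h 2 2 (by norm_num) (by norm_num) (by norm_num)
  norm_num [rpAbs] at h11 h12 h13 h22
  refine hne 1 one_ne_zero ?_
  linear_combination 2 * h11 - (5 / 6 : ℂ) * h12 - (3 / 8 : ℂ) * h13 + (3 / 8 : ℂ) * h22
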